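/- If ρ(A) ≤ 1, a24 > (1/2)·√(1 − 2s) and a45 > (1/2)·√(1 − 2s), then a24 < (1/2)·√(3 − 2s), a45 < (1/2)·√(3 − 2s), a25 < 1/(2(1 − s)), and S2 > 0. -/

import Mathlib

/-- A real symmetric matrix with spectral radius at most one is at most the identity. -/
theorem Matrix.posSemidef_one_sub_of_spectralRadius_le_one {n : Type*} [Fintype n]
    [DecidableEq n] {A : Matrix n n ℝ} (hA : A.IsHermitian) (hρ : spectralRadius ℝ A ≤ 1) :
    (1 - A).PosSemidef := by
  rw [Matrix.posSemidef_iff_isHermitian_and_spectrum_nonneg]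
  refine ⟨Matrix.isHermitian_one.sub hA, fun x hx => ?_⟩
  have hx' : 1 - x ∈ spectrum ℝ A := by
    rw [spectrum.mem_iff] at hx ⊢
    contrapose! hx
    convert hx.neg using 1
    simp only [map_sub, map_one]
    abel
  have h : (‖1 - x‖₊ : ENNReal) ≤ 1 :=
    (le_iSup₂ (f := fun k (_ : k ∈ spectrum ℝ A) => (‖k‖₊ : ENNReal)) _ hx').trans hρ
  have h' : ‖1 - x‖ ≤ 1 := by exact_mod_cast h
  rw [Real.norm_eq_abs, abs_le] at h'
  change 0 ≤ x
  linarith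


/-- Pattern H: if `ρ(A) ≤ 1`, `a24 > √(1-2s)/2` and `a45 > √(1-2s)/2`, then
`a24 < √(3-2s)/2`, `a45 < √(3-2s)/2`, `a25 < 1/(2(1-s))` and `S2 > 0`. -/
theorem stmt_6
    (s t a12 a13 a24 a25 a35 a45 : ℝ)
    (hs : 0 ≤ s) (ht : 0 ≤ t) (h12n : 0 ≤ a12) (h13n : 0 ≤ a13)
    (h24n : 0 ≤ a24) (h25n : 0 ≤ a25) (h35n : 0 ≤ a35) (h45n : 0 ≤ a45)
    (hts : t + s ≤ 1/2)
    (A : Matrix (Fin 5) (Fin 5) ℝ)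
    (hA : A = !![1/2 - t - s, a12, a13, 0, 0;
                 a12, 0, 0, a24, a25;
                 a13, 0, t, 0, a35;
                 0, a24, 0, s, a45;
                 0, a25, a35, a45, 0])
    (S2 : ℝ) (hS2 : S2 = -1 + 2*s + 4*a24^2 + 4*(1 - 2*s)*a25^2 + 4*a45^2 + 16*a24*a25*a45)
    (hρ : spectralRadius ℝ A ≤ 1)
    (h24 : a24 > 1/2 * Real.sqrt (1 - 2*s))
    (h45 : a45 > 1/2 * Real.sqrt (1 - 2*s)) :
    a24 < 1/2 * Real.sqrt (3 - 2*s) ∧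
    a45 < 1/2 * Real.sqrt (3 - 2*s) ∧
    a25 < 1 / (2 * (1 - s)) ∧
    S2 > 0 := by
  have hpos : (1 - A).PosSemidef := by
    apply Matrix.posSemidef_one_sub_of_spectralRadius_le_one _ hρ
    rw [hA]
    ext i j
    fin_cases i <;> fin_cases j <;> simp
  have hdet := (hpos.submatrix ![1, 3, 4]).det_nonneg
  rw [hA, Matrix.det_fin_three] at hdet
  simp at hdet
  have q24 : (1 - 2*s) / 4 < a24^2 := by
    have h := pow_lt_pow_left₀ h24 (by positivity) two_ne_zero
    rw [mul_pow, Real.sq_sqrt (by linarith)] at h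
    linarith
  have q45 : (1 - 2*s) / 4 < a45^2 := by
    have h := pow_lt_pow_left₀ h45 (by positivity) two_ne_zero
    rw [mul_pow, Real.sq_sqrt (by linarith)] at h
    linarith
  have hprod : (1 - 2*s) / 4 ≤ a24 * a45 := by
    have h := mul_le_mul h24.le h45.le (by positivity) h24n
    have h' := Real.mul_self_sqrt (show 0 ≤ 1 - 2*s by linarith)
    linarith
  have hcross : (1 - 2*s) / 4 * a25 ≤ a24 * a45 * a25 :=
    mul_le_mul_of_nonneg_right hprod h25n
  have hdet' : a24^2 + a45^2 + (1 - s) * a25^2 + 2 * (a24 * a45 * a25) ≤ 1 - s := by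
    linarith
  have hsq : 0 ≤ (1 - s) * a25^2 := mul_nonneg (by linarith) (sq_nonneg _)
  have hcross0 : 0 ≤ a24 * a45 * a25 := by positivity
  have bound : ∀ x : ℝ, x^2 < (3 - 2*s) / 4 → x < 1/2 * Real.sqrt (3 - 2*s) := by
    intro x hx
    have h := Real.lt_sqrt_of_sq_lt (show (2*x)^2 < 3 - 2*s by linarith)
    linarith
  refine ⟨bound _ (by linarith), bound _ (by linarith), ?_, ?_⟩
  · rw [lt_div_iff₀ (by linarith)]
    have h : 0 < (1 - a25 * (2 * (1 - s))) * (1 + a25) := by linarith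
    linarith [pos_of_mul_pos_left h (by linarith)]
  · have h1 : 0 ≤ 4 * (1 - 2*s) * a25^2 := mul_nonneg (by linarith) (sq_nonneg _)
    linarith
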